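/- arXiv:1501.00337 — 8 statements merged into one kernel-verified Lean document; each statement's English description precedes it below -/
import Mathlib

section
/- Let Θ ∈ ℝ∖ℤ and let ρ ∈ ℂ be such that it is NOT the case that Re ρ = 0 and |Im ρ| ≥ |Θ|. Define c(ρ) = −(1/(4π))·Log[(1+ρ²/Θ²)·sin²(πΘ)], a(ρ) = (1/(2√π))·Γ(1+2ic(ρ))·e^{iπ/4}·e^{−6ic(ρ)·log 2}·e^{πc(ρ)}·[cos(πΘ) − (ρ/Θ)sin(πΘ)], and b(ρ) = (1/(2√π))·Γ(1−2ic(ρ))·e^{−iπ/4}·e^{6ic(ρ)·log 2}·e^{πc(ρ)}·[cos(πΘ) + (ρ/Θ)sin(πΘ)]. Then a(ρ)·b(ρ) = c(ρ). -/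
/-- The quantity `c(ρ)` from the connection formulas of the fifth Painlevé equation. -/
noncomputable def cFun (Θ : ℝ) (ρ : ℂ) : ℂ :=
  -(1 / (4 * (Real.pi : ℂ))) *
    Complex.log ((1 + ρ ^ 2 / (Θ : ℂ) ^ 2) * Complex.sin ((Real.pi : ℂ) * (Θ : ℂ)) ^ 2)

/-- The connection coefficient `a(ρ)`. -/
noncomputable def aFun (Θ : ℝ) (ρ : ℂ) : ℂ :=
  (1 / (2 * (Real.sqrt Real.pi : ℂ))) * Complex.Gamma (1 + 2 * Complex.I * cFun Θ ρ) *
    Complex.exp (Complex.I * (Real.pi : ℂ) / 4) *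
    Complex.exp (-(6 * Complex.I * cFun Θ ρ * (Real.log 2 : ℂ))) *
    Complex.exp ((Real.pi : ℂ) * cFun Θ ρ) *
    (Complex.cos ((Real.pi : ℂ) * (Θ : ℂ)) - ρ / (Θ : ℂ) * Complex.sin ((Real.pi : ℂ) * (Θ : ℂ)))

/-- The connection coefficient `b(ρ)`. -/
noncomputable def bFun (Θ : ℝ) (ρ : ℂ) : ℂ :=
  (1 / (2 * (Real.sqrt Real.pi : ℂ))) * Complex.Gamma (1 - 2 * Complex.I * cFun Θ ρ) *
    Complex.exp (-(Complex.I * (Real.pi : ℂ)) / 4) *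
    Complex.exp (6 * Complex.I * cFun Θ ρ * (Real.log 2 : ℂ)) *
    Complex.exp ((Real.pi : ℂ) * cFun Θ ρ) *
    (Complex.cos ((Real.pi : ℂ) * (Θ : ℂ)) + ρ / (Θ : ℂ) * Complex.sin ((Real.pi : ℂ) * (Θ : ℂ)))

lemma gamma_key (c : ℂ)
    (h : Complex.exp (2 * Real.pi * c) - Complex.exp (-(2 * Real.pi * c)) ≠ 0) :
    Complex.Gamma (1 + 2 * Complex.I * c) * Complex.Gamma (1 - 2 * Complex.I * c) *
      (Complex.exp (2 * Real.pi * c) - Complex.exp (-(2 * Real.pi * c))) = 4 * Real.pi * c := by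
  have hc : c ≠ 0 := by
    rintro rfl
    simp at h
  have hs : 2 * Complex.I * c ≠ 0 := by simp [hc]
  have h1 := Complex.Gamma_mul_Gamma_one_sub (2 * Complex.I * c)
  have h2 := Complex.Gamma_add_one (2 * Complex.I * c) hs
  have e1 : -((Real.pi : ℂ) * (2 * Complex.I * c)) * Complex.I = 2 * Real.pi * c := by
    linear_combination (-2 * Real.pi * c : ℂ) * Complex.I_sq
  have e2 : ((Real.pi : ℂ) * (2 * Complex.I * c)) * Complex.I = -(2 * Real.pi * c) := by
    linear_combination (2 * Real.pi * c : ℂ) * Complex.I_sq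
  rw [Complex.sin, e1, e2] at h1
  rw [add_comm, h2, mul_assoc (2 * Complex.I * c), h1]
  have := Complex.I_ne_zero
  generalize Complex.exp (2 * Real.pi * c) - Complex.exp (-(2 * Real.pi * c)) = D at h ⊢
  field_simp
  norm_num

/-- The product of the connection coefficients satisfies `a(ρ)·b(ρ) = c(ρ)`. -/
theorem aFun_mul_bFun (Θ : ℝ) (hΘ : ∀ n : ℤ, Θ ≠ (n : ℝ))
    (ρ : ℂ) (hρ : ¬(ρ.re = 0 ∧ |Θ| ≤ |ρ.im|)) :
    aFun Θ ρ * bFun Θ ρ = cFun Θ ρ := by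
  have hΘ0 : (Θ : ℂ) ≠ 0 := by
    have := hΘ 0
    simpa using this
  have hpi : (Real.pi : ℂ) ≠ 0 := by exact_mod_cast Real.pi_ne_zero
  have hsin : Complex.sin ((Real.pi : ℂ) * (Θ : ℂ)) ≠ 0 := by
    rw [Ne, Complex.sin_eq_zero_iff]
    rintro ⟨k, hk⟩
    apply hΘ k
    have h : (Θ : ℂ) = (k : ℂ) := by
      apply mul_left_cancel₀ hpi
      rw [hk, mul_comm]
    exact_mod_cast h
  have hne : 1 + ρ ^ 2 / (Θ : ℂ) ^ 2 ≠ 0 := by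
    intro h
    field_simp at h
    have h' : (ρ - Complex.I * Θ) * (ρ + Complex.I * Θ) = 0 := by
      linear_combination h - (Θ : ℂ) ^ 2 * Complex.I_sq
    apply hρ
    rcases mul_eq_zero.mp h' with h1 | h1
    · have : ρ = Complex.I * Θ := by linear_combination h1
      subst this
      simp
    · have : ρ = -(Complex.I * Θ) := by linear_combination h1
      subst this
      simp
  set X : ℂ := (1 + ρ ^ 2 / (Θ : ℂ) ^ 2) * Complex.sin ((Real.pi : ℂ) * (Θ : ℂ)) ^ 2 with hX
  have hX0 : X ≠ 0 := mul_ne_zero hne (pow_ne_zero _ hsin)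
  have hcos : (Complex.cos ((Real.pi : ℂ) * Θ) - ρ / Θ * Complex.sin ((Real.pi : ℂ) * Θ)) *
      (Complex.cos ((Real.pi : ℂ) * Θ) + ρ / Θ * Complex.sin ((Real.pi : ℂ) * Θ)) = 1 - X := by
    rw [hX, ← div_pow]
    linear_combination Complex.sin_sq_add_cos_sq ((Real.pi : ℂ) * Θ)
  have hcX : cFun Θ ρ = -(1 / (4 * (Real.pi : ℂ))) * Complex.log X := rfl
  have hsq : (Real.sqrt Real.pi : ℂ) * (Real.sqrt Real.pi : ℂ) = Real.pi := by
    exact_mod_cast Real.mul_self_sqrt Real.pi_pos.le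
  have hsq0 : (Real.sqrt Real.pi : ℂ) ≠ 0 := by
    intro h
    rw [h] at hsq
    exact hpi (by simpa using hsq.symm)
  have hEX : Complex.exp (-(4 * Real.pi * cFun Θ ρ)) = X := by
    rw [hcX, show -(4 * (Real.pi : ℂ) * (-(1 / (4 * (Real.pi : ℂ))) * Complex.log X))
      = Complex.log X by field_simp, Complex.exp_log hX0]
  unfold aFun bFun
  generalize cFun Θ ρ = c at hcX hEX
  have x1 : Complex.exp (Complex.I * (Real.pi : ℂ) / 4) *
      Complex.exp (-(Complex.I * (Real.pi : ℂ)) / 4) = 1 := by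
    rw [← Complex.exp_add, ← Complex.exp_zero]
    congr 1
    ring
  have x2 : Complex.exp (-(6 * Complex.I * c * (Real.log 2 : ℂ))) *
      Complex.exp (6 * Complex.I * c * (Real.log 2 : ℂ)) = 1 := by
    rw [← Complex.exp_add, ← Complex.exp_zero]
    congr 1
    ring
  have x3 : Complex.exp ((Real.pi : ℂ) * c) * Complex.exp ((Real.pi : ℂ) * c) =
      Complex.exp (2 * Real.pi * c) := by
    rw [← Complex.exp_add]
    congr 1
    ring
  have x4 : (1 / (2 * (Real.sqrt Real.pi : ℂ))) * (1 / (2 * (Real.sqrt Real.pi : ℂ))) =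
      1 / (4 * Real.pi) := by
    rw [← hsq]
    field_simp
    norm_num
  have x5 : Complex.exp (2 * Real.pi * c) * (1 - X) =
      Complex.exp (2 * Real.pi * c) - Complex.exp (-(2 * Real.pi * c)) := by
    rw [← hEX, mul_sub, mul_one, ← Complex.exp_add]
    congr 2
    ring
  calc _ = ((1 / (2 * (Real.sqrt Real.pi : ℂ))) * (1 / (2 * (Real.sqrt Real.pi : ℂ)))) *
        (Complex.exp (Complex.I * (Real.pi : ℂ) / 4) *
          Complex.exp (-(Complex.I * (Real.pi : ℂ)) / 4)) *
        (Complex.exp (-(6 * Complex.I * c * (Real.log 2 : ℂ))) *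
          Complex.exp (6 * Complex.I * c * (Real.log 2 : ℂ))) *
        (Complex.Gamma (1 + 2 * Complex.I * c) * Complex.Gamma (1 - 2 * Complex.I * c)) *
        ((Complex.exp ((Real.pi : ℂ) * c) * Complex.exp ((Real.pi : ℂ) * c)) *
        ((Complex.cos ((Real.pi : ℂ) * Θ) - ρ / Θ * Complex.sin ((Real.pi : ℂ) * Θ)) *
        (Complex.cos ((Real.pi : ℂ) * Θ) + ρ / Θ * Complex.sin ((Real.pi : ℂ) * Θ)))) := by ring
    _ = 1 / (4 * Real.pi) *
        (Complex.Gamma (1 + 2 * Complex.I * c) * Complex.Gamma (1 - 2 * Complex.I * c) *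
        (Complex.exp (2 * Real.pi * c) - Complex.exp (-(2 * Real.pi * c)))) := by
      rw [x1, x2, x3, x4, hcos, x5]
      ring
    _ = c := by
      by_cases h : Complex.exp (2 * Real.pi * c) - Complex.exp (-(2 * Real.pi * c)) = 0
      · rw [h]
        rw [h] at x5
        have hX1 : X = 1 := by
          rcases mul_eq_zero.mp x5 with h1 | h1
          · exact absurd h1 (Complex.exp_ne_zero _)
          · exact (sub_eq_zero.mp h1).symm
        rw [hcX, hX1]
        simp
      · rw [gamma_key c h]
        field_simp
end

section
/- Let Θ ∈ ℂ, let I ⊆ (0,∞) be an open interval, and let y, v : I → ℂ be differentiable functions with y(x) ≠ 0 and y(x) ≠ 1 for all x ∈ I. Suppose that for all x ∈ I: x·y'(x) = x·y(x) − 2v(x)·(y(x)−1)² + 2Θ·(y(x)−1) and x·v'(x) = y(x)·v(x)² − (v(x)+Θ)²/y(x). Then y is twice differentiable on I and satisfies the fifth Painlevé equation PV(Θ): y''(x) = (1/(2y) + 1/(y−1))·(y'(x))² − y'(x)/x + (1−2Θ)·y(x)/x − y(x)(y(x)+1)/(2(y(x)−1)) for all x ∈ I. -/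
/-- Two equations of the isomonodromy deformation system of the Painlevé V Lax pair
imply that `y` is twice differentiable and satisfies the fifth Painlevé equation `PV(Θ)`. -/
theorem isomonodromy_system_implies_painleveV
    (Θ : ℂ) (p q : ℝ) (hsub : Set.Ioo p q ⊆ Set.Ioi (0 : ℝ))
    (y v y' v' : ℝ → ℂ)
    (hy : ∀ x ∈ Set.Ioo p q, HasDerivAt y (y' x) x)
    (hv : ∀ x ∈ Set.Ioo p q, HasDerivAt v (v' x) x)
    (hyne0 : ∀ x ∈ Set.Ioo p q, y x ≠ 0)
    (hyne1 : ∀ x ∈ Set.Ioo p q, y x ≠ 1)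
    (heq1 : ∀ x ∈ Set.Ioo p q,
      (x : ℂ) * y' x = (x : ℂ) * y x - 2 * v x * (y x - 1) ^ 2 + 2 * Θ * (y x - 1))
    (heq2 : ∀ x ∈ Set.Ioo p q,
      (x : ℂ) * v' x = y x * (v x) ^ 2 - (v x + Θ) ^ 2 / y x) :
    ∃ y'' : ℝ → ℂ, ∀ x ∈ Set.Ioo p q, HasDerivAt y' (y'' x) x ∧
      y'' x = (1 / (2 * y x) + 1 / (y x - 1)) * (y' x) ^ 2 - y' x / (x : ℂ) +
        (1 - 2 * Θ) * y x / (x : ℂ) - y x * (y x + 1) / (2 * (y x - 1)) := by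
  refine ⟨fun x => (1 / (2 * y x) + 1 / (y x - 1)) * (y' x) ^ 2 - y' x / (x : ℂ) +
        (1 - 2 * Θ) * y x / (x : ℂ) - y x * (y x + 1) / (2 * (y x - 1)), fun x hx => ⟨?_, rfl⟩⟩
  have hx0 : (x : ℂ) ≠ 0 := by
    have h : (0 : ℝ) < x := hsub hx
    exact_mod_cast h.ne'
  have hy0 := hyne0 x hx
  have hu : y x - 1 ≠ 0 := sub_ne_zero.mpr (hyne1 x hx)
  have hid : HasDerivAt (fun t : ℝ => (t : ℂ)) 1 x := Complex.ofRealCLM.hasDerivAt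
  have hyx := hy x hx
  have hvx := hv x hx
  have hF := (((hid.mul hyx).sub ((hvx.const_mul 2).mul ((hyx.sub_const 1).pow 2))).add
    ((hyx.sub_const 1).const_mul (2 * Θ))).div hid hx0
  have hev : y' =ᶠ[nhds x] fun t : ℝ =>
      ((t : ℂ) * y t - 2 * v t * (y t - 1) ^ 2 + 2 * Θ * (y t - 1)) / (t : ℂ) := by
    filter_upwards [isOpen_Ioo.mem_nhds hx] with t ht
    have ht0 : (t : ℂ) ≠ 0 := by
      have h : (0 : ℝ) < t := hsub ht
      exact_mod_cast h.ne'
    rw [← heq1 t ht]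
    field_simp
  refine (hF.congr_of_eventuallyEq hev).congr_deriv ?_
  have e1 : y' x = ((x : ℂ) * y x - 2 * v x * (y x - 1) ^ 2 + 2 * Θ * (y x - 1)) / (x : ℂ) := by
    rw [← heq1 x hx]
    field_simp
  have e2 : v' x = (y x * (v x) ^ 2 - (v x + Θ) ^ 2 / y x) / (x : ℂ) := by
    rw [← heq2 x hx]
    field_simp
  simp only [Pi.mul_apply, Pi.sub_apply, Pi.add_apply, Pi.pow_apply]
  rw [e1, e2]
  field_simp
  push_cast
  ring
end

section
/- Let Θ ∈ ℂ and let w : (0,∞) → ℂ be twice differentiable with w(t) ∉ {0, 1, −1} for all t > 0, satisfying the third Painlevé equation PIII(Θ): w''(t) = (w'(t))²/w(t) − w'(t)/t + (1−2Θ)(w(t)²−1)/t + w(t)³ − 1/w(t) for all t > 0. Define y : (0,∞) → ℂ by y(x) = ((w(x/4) − 1)/(w(x/4) + 1))². Then y(x) ∉ {0,1} for all x > 0, and y satisfies the fifth Painlevé equation PV(Θ): y''(x) = (1/(2y) + 1/(y−1))·(y'(x))² − y'(x)/x + (1−2Θ)·y(x)/x − y(x)(y(x)+1)/(2(y(x)−1))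 for all x > 0. -/
/-- If `w` solves the third Painlevé equation `PIII(Θ)` on `(0,∞)` and avoids `0, 1, -1`,
then `y(x) = ((w(x/4) - 1)/(w(x/4) + 1))²` avoids `0, 1` and solves the fifth Painlevé
equation `PV(Θ)` on `(0,∞)`. -/
theorem painleveIII_to_painleveV
    (Θ : ℂ) (w w' w'' : ℝ → ℂ)
    (hw1 : ∀ t : ℝ, 0 < t → HasDerivAt w (w' t) t)
    (hw2 : ∀ t : ℝ, 0 < t → HasDerivAt w' (w'' t) t)
    (hwne0 : ∀ t : ℝ, 0 < t → w t ≠ 0)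
    (hwne1 : ∀ t : ℝ, 0 < t → w t ≠ 1)
    (hwnem1 : ∀ t : ℝ, 0 < t → w t ≠ -1)
    (hPIII : ∀ t : ℝ, 0 < t →
      w'' t = (w' t) ^ 2 / w t - w' t / (t : ℂ) + (1 - 2 * Θ) * ((w t) ^ 2 - 1) / (t : ℂ) +
        (w t) ^ 3 - 1 / w t)
    (y : ℝ → ℂ) (hy : ∀ x : ℝ, y x = ((w (x / 4) - 1) / (w (x / 4) + 1)) ^ 2) :
    (∀ x : ℝ, 0 < x → y x ≠ 0 ∧ y x ≠ 1) ∧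
    ∃ y' y'' : ℝ → ℂ,
      (∀ x : ℝ, 0 < x → HasDerivAt y (y' x) x) ∧
      (∀ x : ℝ, 0 < x → HasDerivAt y' (y'' x) x) ∧
      (∀ x : ℝ, 0 < x →
        y'' x = (1 / (2 * y x) + 1 / (y x - 1)) * (y' x) ^ 2 - y' x / (x : ℂ) +
          (1 - 2 * Θ) * y x / (x : ℂ) - y x * (y x + 1) / (2 * (y x - 1))) := by
  have hp : ∀ x : ℝ, 0 < x → w (x / 4) + 1 ≠ 0 := fun x hx h =>
    hwnem1 (x / 4) (by positivity) (eq_neg_of_add_eq_zero_left h)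
  have hm : ∀ x : ℝ, 0 < x → w (x / 4) - 1 ≠ 0 := fun x hx h =>
    hwne1 (x / 4) (by positivity) (sub_eq_zero.mp h)
  have hy1 : ∀ x : ℝ, 0 < x → y x - 1 = -4 * w (x / 4) / (w (x / 4) + 1) ^ 2 := by
    intro x hx
    have := hp x hx
    rw [hy]
    field_simp
    ring
  have hdiv : ∀ x : ℝ, HasDerivAt (fun x : ℝ => x / 4) (1 / 4) x := fun x =>
    (hasDerivAt_id x).div_const 4
  have hW : ∀ x : ℝ, 0 < x → HasDerivAt (fun x : ℝ => w (x / 4)) (w' (x / 4) / 4) x := by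
    intro x hx
    have h := HasDerivAt.scomp x (hw1 (x / 4) (by positivity)) (hdiv x)
    refine h.congr_deriv ?_
    rw [Complex.real_smul]; push_cast; ring
  have hW' : ∀ x : ℝ, 0 < x → HasDerivAt (fun x : ℝ => w' (x / 4)) (w'' (x / 4) / 4) x := by
    intro x hx
    have h := HasDerivAt.scomp x (hw2 (x / 4) (by positivity)) (hdiv x)
    refine h.congr_deriv ?_
    rw [Complex.real_smul]; push_cast; ring
  refine ⟨fun x hx => ⟨?_, ?_⟩, fun x => w' (x / 4) * (w (x / 4) - 1) / (w (x / 4) + 1) ^ 3,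
    fun x => (w'' (x / 4) * (w (x / 4) - 1) / (w (x / 4) + 1) ^ 3
      + w' (x / 4) ^ 2 * (4 - 2 * w (x / 4)) / (w (x / 4) + 1) ^ 4) / 4, ?_, ?_, ?_⟩
  · rw [hy]
    exact pow_ne_zero _ (div_ne_zero (hm x hx) (hp x hx))
  · rw [← sub_ne_zero, hy1 x hx]
    exact div_ne_zero (mul_ne_zero (by norm_num) (hwne0 _ (by positivity)))
      (pow_ne_zero _ (hp x hx))
  · intro x hx
    have h1 := hp x hx
    rw [funext hy]
    refine ((((hW x hx).sub_const 1).fun_div ((hW x hx).add_const 1) h1).fun_pow 2).congr_deriv ?_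
    push_cast
    field_simp
    ring
  · intro x hx
    have h1 := hp x hx
    refine (((hW' x hx).fun_mul ((hW x hx).sub_const 1)).fun_div
      (((hW x hx).add_const 1).fun_pow 3) (pow_ne_zero 3 h1)).congr_deriv ?_
    push_cast
    field_simp
    ring
  · intro x hx
    have h1 := hp x hx
    have h2 := hm x hx
    have h0 := hwne0 (x / 4) (by positivity)
    have hxc : (x : ℂ) ≠ 0 := by exact_mod_cast hx.ne'
    have hP := hPIII (x / 4) (by positivity)
    beta_reduce
    rw [hy1 x hx, hP, hy]
    push_cast
    generalize w (x / 4) = a at *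
    generalize w' (x / 4) = b at *
    field_simp
    ring
end

section
/- Let φ : (0,∞) → ℂ be twice differentiable and define w : (0,∞) → ℂ by w(t) = −e^{iφ(t)}. Then w satisfies the third Painlevé equation PIII(0): w''(t) = (w'(t))²/w(t) − w'(t)/t + (w(t)²−1)/t + w(t)³ − 1/w(t) for all t > 0, if and only if φ satisfies (t·φ'(t))' − 2t·sin(2φ(t)) + 2·sin(φ(t)) = 0 for all t > 0, i.e., t·φ''(t) + φ'(t) − 2t·sin(2φ(t)) + 2·sin(φ(t)) = 0. -/
/-- With `w(t) = -e^{iφ(t)}`, the third Painlevé equation `PIII(0)` for `w` is equivalent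
to the equation `(tφ')' - 2t·sin 2φ + 2·sin φ = 0` for `φ`. -/
theorem painleveIII_zero_iff_harmonic_equation
    (φ φ' φ'' : ℝ → ℂ)
    (hφ1 : ∀ t : ℝ, 0 < t → HasDerivAt φ (φ' t) t)
    (hφ2 : ∀ t : ℝ, 0 < t → HasDerivAt φ' (φ'' t) t)
    (w : ℝ → ℂ) (hw : ∀ t : ℝ, w t = -Complex.exp (Complex.I * φ t)) :
    (∀ t : ℝ, 0 < t →
      deriv (deriv w) t = (deriv w t) ^ 2 / w t - deriv w t / (t : ℂ) +
        ((w t) ^ 2 - 1) / (t : ℂ) + (w t) ^ 3 - 1 / w t)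
    ↔ (∀ t : ℝ, 0 < t →
      (t : ℂ) * φ'' t + φ' t - 2 * (t : ℂ) * Complex.sin (2 * φ t) +
        2 * Complex.sin (φ t) = 0) := by
  have h1 : ∀ t : ℝ, 0 < t → HasDerivAt w (Complex.I * φ' t * w t) t := by
    intro t ht
    have h := (((hφ1 t ht).const_mul Complex.I).cexp).neg
    have hfun : w = -(fun t => Complex.exp (Complex.I * φ t)) := by
      funext s
      simp [hw s]
    rw [← hfun] at h
    have hv : -(Complex.exp (Complex.I * φ t) * (Complex.I * φ' t)) =
        Complex.I * φ' t * w t := by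
      rw [hw t]
      ring
    exact hv ▸ h
  have hd : ∀ t : ℝ, 0 < t → deriv w t = Complex.I * φ' t * w t :=
    fun t ht => (h1 t ht).deriv
  have h2 : ∀ t : ℝ, 0 < t →
      deriv (deriv w) t = Complex.I * φ'' t * w t - (φ' t) ^ 2 * w t := by
    intro t ht
    have he : deriv w =ᶠ[nhds t] fun s => Complex.I * φ' s * w s := by
      filter_upwards [lt_mem_nhds ht] with s hs using hd s hs
    rw [he.deriv_eq]
    have h := (((hφ2 t ht).const_mul Complex.I).mul (h1 t ht)).deriv
    refine h.trans ?_
    linear_combination (φ' t) ^ 2 * w t * Complex.I_sq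
  refine forall_congr' fun t => forall_congr' fun ht => ?_
  have htc : (t : ℂ) ≠ 0 := by exact_mod_cast ht.ne'
  have hw0 : w t ≠ 0 := by
    rw [hw t]
    exact neg_ne_zero.mpr (Complex.exp_ne_zero _)
  have e1 : Complex.exp (φ t * Complex.I) = -w t := by
    rw [hw t, mul_comm, neg_neg]
  have e2 : Complex.exp (-φ t * Complex.I) = -(w t)⁻¹ := by
    rw [neg_mul, Complex.exp_neg, e1, inv_neg]
  have s1 : Complex.sin (φ t) = (w t - (w t)⁻¹) * Complex.I / 2 := by
    rw [Complex.sin, e1, e2]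
    ring
  have s2 : Complex.sin (2 * φ t) = ((w t)⁻¹ ^ 2 - (w t) ^ 2) * Complex.I / 2 := by
    have e3 : Complex.exp (2 * φ t * Complex.I) = (w t) ^ 2 := by
      rw [show 2 * φ t * Complex.I = φ t * Complex.I + φ t * Complex.I by ring,
        Complex.exp_add, e1]
      ring
    have e4 : Complex.exp (-(2 * φ t) * Complex.I) = (w t)⁻¹ ^ 2 := by
      rw [neg_mul, Complex.exp_neg, e3, inv_pow]
    rw [Complex.sin, e3, e4]
  have key : (Complex.I * φ'' t * w t - (φ' t) ^ 2 * w t -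
      ((Complex.I * φ' t * w t) ^ 2 / w t - Complex.I * φ' t * w t / (t : ℂ) +
        ((w t) ^ 2 - 1) / (t : ℂ) + (w t) ^ 3 - 1 / w t)) =
      Complex.I * w t / t * ((t : ℂ) * φ'' t + φ' t - 2 * (t : ℂ) * Complex.sin (2 * φ t) +
        2 * Complex.sin (φ t)) := by
    rw [s1, s2]
    have hI := Complex.I_sq
    generalize Complex.I = j at *
    have hj : (j * φ' t * w t) ^ 2 = -(φ' t) ^ 2 * (w t) ^ 2 := by
      linear_combination (φ' t) ^ 2 * (w t) ^ 2 * hI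
    rw [hj]
    field_simp
    ring_nf
    simp only [hI]
    ring
  rw [h2 t ht, hd t ht, ← sub_eq_zero, key]
  have hc : Complex.I * w t / t ≠ 0 := div_ne_zero (mul_ne_zero Complex.I_ne_zero hw0) htc
  exact mul_eq_zero.trans (or_iff_right hc)
end

section
/- Let U ⊆ ℂ be an open set and let Φ : U → ℂ be holomorphic satisfying t·Φ''(t) + Φ'(t) − 2t·sin(2Φ(t)) + 2·sin(Φ(t)) = 0 for all t ∈ U, with cos(Φ(t)/2) ≠ 0, tan(Φ(t)/2) ≠ 0, and tan²(Φ(t)/2) ≠ 1 for all t ∈ U. Let U' = {2it : t ∈ U} and let V : U' → ℂ be holomorphic with e^{iV(2it)} = i·tan(Φ(t)/2) for all t ∈ U. Then for every t ∈ U, writing z = 2it, one has sin(V(z)) ≠ 0 and V''(z) = ((V'(z))² − 1)·cot(V(z)) + (1/z)·(1 − V'(z)). -/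
/-- If a holomorphic `Φ` satisfies `tΦ'' + Φ' - 2t·sin 2Φ + 2·sin Φ = 0` on an open set
`U`, and `V` is holomorphic on `U' = {2it : t ∈ U}` with `e^{iV(2it)} = i·tan(Φ(t)/2)`,
then `V` satisfies `V'' = ((V')² - 1)·cot V + (1/z)(1 - V')` at `z = 2it`. -/
theorem harmonic_equation_to_boson_equation
    (U : Set ℂ) (hU : IsOpen U) (Φ : ℂ → ℂ) (hΦ : DifferentiableOn ℂ Φ U)
    (hode : ∀ t ∈ U,
      t * deriv (deriv Φ) t + deriv Φ t - 2 * t * Complex.sin (2 * Φ t) +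
        2 * Complex.sin (Φ t) = 0)
    (hcos : ∀ t ∈ U, Complex.cos (Φ t / 2) ≠ 0)
    (htan : ∀ t ∈ U, Complex.tan (Φ t / 2) ≠ 0)
    (htan2 : ∀ t ∈ U, Complex.tan (Φ t / 2) ^ 2 ≠ 1)
    (V : ℂ → ℂ) (hV : DifferentiableOn ℂ V ((fun t => 2 * Complex.I * t) '' U))
    (hVeq : ∀ t ∈ U,
      Complex.exp (Complex.I * V (2 * Complex.I * t)) = Complex.I * Complex.tan (Φ t / 2)) :
    ∀ t ∈ U, Complex.sin (V (2 * Complex.I * t)) ≠ 0 ∧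
      deriv (deriv V) (2 * Complex.I * t) =
        ((deriv V (2 * Complex.I * t)) ^ 2 - 1) *
          (Complex.cos (V (2 * Complex.I * t)) / Complex.sin (V (2 * Complex.I * t))) +
        (1 / (2 * Complex.I * t)) * (1 - deriv V (2 * Complex.I * t)) := by
  have hI : Complex.I ^ 2 = -1 := Complex.I_sq
  have hI0 : Complex.I ≠ 0 := Complex.I_ne_zero
  have h2I : (2 * Complex.I : ℂ) ≠ 0 := mul_ne_zero two_ne_zero hI0
  have hU' : IsOpen ((fun t => 2 * Complex.I * t) '' U) :=
    (Homeomorph.mulLeft₀ (2 * Complex.I) h2I).isOpenMap U hU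
  have hV' := hV.deriv hU'
  have hΦ' := hΦ.deriv hU
  have dΦ : ∀ t ∈ U, HasDerivAt Φ (deriv Φ t) t := fun t ht =>
    ((hΦ t ht).differentiableAt (hU.mem_nhds ht)).hasDerivAt
  have dΦ' : ∀ t ∈ U, HasDerivAt (deriv Φ) (deriv (deriv Φ) t) t := fun t ht =>
    ((hΦ' t ht).differentiableAt (hU.mem_nhds ht)).hasDerivAt
  have dl : ∀ t : ℂ, HasDerivAt (fun t => 2 * Complex.I * t) (2 * Complex.I) t := fun t => by
    simpa using (hasDerivAt_id t).const_mul (2 * Complex.I)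
  have dV : ∀ t ∈ U, HasDerivAt (fun t => V (2 * Complex.I * t))
      (deriv V (2 * Complex.I * t) * (2 * Complex.I)) t := fun t ht =>
    HasDerivAt.comp t (((hV _ ⟨t, ht, rfl⟩).differentiableAt
      (hU'.mem_nhds ⟨t, ht, rfl⟩)).hasDerivAt) (dl t)
  have dV' : ∀ t ∈ U, HasDerivAt (fun t => deriv V (2 * Complex.I * t))
      (deriv (deriv V) (2 * Complex.I * t) * (2 * Complex.I)) t := fun t ht =>
    HasDerivAt.comp t (((hV' _ ⟨t, ht, rfl⟩).differentiableAt
      (hU'.mem_nhds ⟨t, ht, rfl⟩)).hasDerivAt) (dl t)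
  have hsh : ∀ t ∈ U, Complex.sin (Φ t / 2) ≠ 0 := fun t ht h => by
    apply htan t ht
    rw [Complex.tan_eq_sin_div_cos, h, zero_div]
  have hs2 : ∀ t, Complex.sin (Φ t) = 2 * Complex.sin (Φ t / 2) * Complex.cos (Φ t / 2) :=
    fun t => by rw [← Complex.sin_two_mul]; congr 1; ring
  have hc2 : ∀ t, Complex.cos (Φ t) = Complex.cos (Φ t / 2) ^ 2 - Complex.sin (Φ t / 2) ^ 2 :=
    fun t => by rw [← Complex.cos_two_mul']; congr 1; ring
  have hs : ∀ t ∈ U, Complex.sin (Φ t) ≠ 0 := fun t ht => by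
    rw [hs2]
    exact mul_ne_zero (mul_ne_zero two_ne_zero (hsh t ht)) (hcos t ht)
  -- first derivative
  have hV1 : ∀ t ∈ U, deriv V (2 * Complex.I * t) * (2 * Complex.sin (Φ t)) = - deriv Φ t := by
    intro t ht
    have h1 := ((dV t ht).const_mul Complex.I).cexp
    have h2 := (((Complex.hasDerivAt_tan (hcos t ht)).comp t
      ((dΦ t ht).div_const 2)).const_mul Complex.I)
    have h3 : (fun t => Complex.exp (Complex.I * V (2 * Complex.I * t))) =ᶠ[nhds t]
        (fun t => Complex.I * (Complex.tan ∘ fun t => Φ t / 2) t) :=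
      Filter.eventually_of_mem (hU.mem_nhds ht) hVeq
    have h4 := (h1.congr_of_eventuallyEq h3.symm).unique h2
    rw [hVeq t ht, Complex.tan_eq_sin_div_cos] at h4
    have a := hcos t ht
    rw [hs2]
    generalize deriv V (2 * Complex.I * t) = v at *
    field_simp at h4
    have hI : Complex.I ^ 2 = -1 := Complex.I_sq
    linear_combination (-1) * h4 + 4 * Complex.sin (Φ t / 2) * Complex.cos (Φ t / 2) * v * hI
  intro t ht
  have hS := hs t ht
  have a := hcos t ht
  have b := hsh t ht
  have hneg : Complex.exp (-(Complex.I * V (2 * Complex.I * t))) =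
      (Complex.I * Complex.tan (Φ t / 2))⁻¹ := by rw [Complex.exp_neg, hVeq t ht]
  have p := Complex.sin_sq_add_cos_sq (Φ t / 2)
  have hsinV : Complex.sin (V (2 * Complex.I * t)) = 1 / Complex.sin (Φ t) := by
    rw [Complex.sin, mul_comm (V _) Complex.I, neg_mul, mul_comm (V _) Complex.I, hneg, hVeq t ht,
      Complex.tan_eq_sin_div_cos, hs2]
    field_simp
    rw [hI]
    linear_combination p
  have hcosV : Complex.cos (V (2 * Complex.I * t)) =
      -Complex.I * Complex.cos (Φ t) / Complex.sin (Φ t) := by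
    rw [Complex.cos, neg_mul, mul_comm (V _) Complex.I, hneg, hVeq t ht,
      Complex.tan_eq_sin_div_cos, hs2, hc2]
    field_simp
    rw [hI]
    ring
  refine ⟨by rw [hsinV]; exact one_div_ne_zero hS, ?_⟩
  have hcot : Complex.cos (V (2 * Complex.I * t)) / Complex.sin (V (2 * Complex.I * t)) =
      -Complex.I * Complex.cos (Φ t) := by
    rw [hsinV, hcosV]; field_simp
  rw [hcot]
  -- second derivative
  have hV2 : deriv (deriv V) (2 * Complex.I * t) * (2 * Complex.I) * (2 * Complex.sin (Φ t)) +
      deriv V (2 * Complex.I * t) * (2 * (Complex.cos (Φ t) * deriv Φ t)) =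
        - deriv (deriv Φ) t := by
    have h1 := (dV' t ht).mul ((dΦ t ht).csin.const_mul 2)
    have h2 := (dΦ' t ht).neg
    exact (h1.congr_of_eventuallyEq
      (Filter.eventually_of_mem (hU.mem_nhds ht) fun x hx => (hV1 x hx).symm)).unique h2
  have e1 := hV1 t ht
  have o := hode t ht
  rw [Complex.sin_two_mul] at o
  generalize deriv (deriv V) (2 * Complex.I * t) = W at *
  generalize deriv V (2 * Complex.I * t) = v at *
  have e1' : deriv Φ t = - (v * (2 * Complex.sin (Φ t))) := by rw [e1]; ring
  rw [e1'] at hV2 o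
  by_cases h0 : t = 0
  · subst h0
    have hd : deriv (deriv Φ) 0 + deriv (deriv Φ) 0 - 4 * Complex.sin (Φ 0) * Complex.cos (Φ 0)
        + 2 * (Complex.cos (Φ 0) * deriv Φ 0) = 0 := by
      -- the ODE divides into a difference quotient; differentiate it at the origin
      have dS := (dΦ 0 ht).const_mul 2 |>.csin
      have d3 := (dΦ' 0 ht)
      have d4 : HasDerivAt (fun t => t * deriv (deriv Φ) t) (deriv (deriv Φ) 0) 0 := by
        have d5 := (((hΦ'.deriv hU) 0 ht).differentiableAt (hU.mem_nhds ht)).hasDerivAt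
        exact ((hasDerivAt_id (0:ℂ)).mul d5).congr_deriv (by simp)
      have d6 : HasDerivAt (fun t => 2 * t * Complex.sin (2 * Φ t)) (2 * Complex.sin (2 * Φ 0)) 0 := by
        exact (((hasDerivAt_id (0:ℂ)).const_mul 2).mul dS).congr_deriv (by simp)
      have d7 := ((d4.add d3).sub d6).add ((dΦ 0 ht).csin.const_mul 2)
      have d8 := (d7.congr_of_eventuallyEq (f₁ := fun _ => (0:ℂ))
        (Filter.eventually_of_mem (hU.mem_nhds ht) fun x hx => (hode x hx).symm)).unique
        (hasDerivAt_const 0 0)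
      rw [Complex.sin_two_mul] at d8
      linear_combination d8
    have hv : v = 1 := by
      have : Complex.sin (Φ 0) * (v - 1) = 0 := by linear_combination (-1/2) * o
      rcases mul_eq_zero.mp this with h | h
      · exact absurd h hS
      · linear_combination h
    subst hv
    rw [e1'] at hd
    have : (Complex.I * Complex.sin (Φ 0)) * W = 0 := by
      linear_combination (1/4) * hV2 - (1/8) * hd
    have := (mul_eq_zero.mp this).resolve_left (mul_ne_zero hI0 hS)
    simp [this]
  · have key : (Complex.I * Complex.sin (Φ t) * t) * (W - ((v ^ 2 - 1) * (-Complex.I * Complex.cos (Φ t)) +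
        1 / (2 * Complex.I * t) * (1 - v))) = 0 := by
      field_simp
      have hI : Complex.I ^ 2 = -1 := Complex.I_sq
      linear_combination (t / 2) * hV2 - (1 / 2) * o + 2 * Complex.sin (Φ t) * t * (v ^ 2 - 1) * Complex.cos (Φ t) * hI
    exact sub_eq_zero.mp ((mul_eq_zero.mp key).resolve_left
      (mul_ne_zero (mul_ne_zero hI0 hS) h0))
end

section
/- Let x, Θ, y, v, u ∈ ℂ with u ≠ 0 and y ≠ 0, let r ∈ ℂ with r² = u, and let U = ℂ∖{0,1}. Define M : U → Matrix 2×2(ℂ) by M(λ) = [[x/2 + (v+Θ/2)/λ − (v+Θ/2)/(λ−1), −u(v+Θ)/λ + y·u·v/(λ−1)], [v/(uλ) − (v+Θ)/(u·y·(λ−1)), −x/2 − (v+Θ/2)/λ + (v+Θ/2)/(λ−1)]]. Let M₁ = (1/√2)·[[1, i],[i, 1]] and D = [[r^{−1}, 0],[0, r]]. If Ψ : U → Matrix 2×2(ℂ) is differentiable with Ψ'(λ) = M(λ)·Ψ(λ), then Ψ̂ := M₁·D·Ψ satisfies Ψ̂'(λ) = [[A(λ), B(λ)],[C(λ), −A(λ)]]·Ψ̂(λ),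 where A(λ) = i·((v+Θ/2)/λ − (y·v + (v+Θ)/y)/(2(λ−1))), B(λ) = −i·(x/2 + (v+Θ/2)/λ − (v+Θ/2)/(λ−1)) + (1/2)·(−Θ/λ + (y·v − (v+Θ)/y)/(λ−1)), and C(λ) = i·(x/2 + (v+Θ/2)/λ − (v+Θ/2)/(λ−1)) + (1/2)·(−Θ/λ + (y·v − (v+Θ)/y)/(λ−1)). -/
/-- The gauge transformation `Ψ̂ = M₁·u^{-σ₃/2}·Ψ` applied to the λ-equation of the
Lax pair of Painlevé V eliminates `u` and produces the coefficient matrix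
`[[A, B], [C, -A]]`. -/
theorem painleveV_gauge_transformation
    (x Θ y v u r : ℂ) (hu : u ≠ 0) (hy : y ≠ 0) (hr : r ^ 2 = u)
    (M : ℂ → Matrix (Fin 2) (Fin 2) ℂ)
    (hM : ∀ l : ℂ, M l =
      !![x / 2 + (v + Θ / 2) / l - (v + Θ / 2) / (l - 1),
          -(u * (v + Θ)) / l + y * u * v / (l - 1);
        v / (u * l) - (v + Θ) / (u * y * (l - 1)),
          -(x / 2) - (v + Θ / 2) / l + (v + Θ / 2) / (l - 1)])
    (M₁ D : Matrix (Fin 2) (Fin 2) ℂ)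
    (hM₁ : M₁ = (1 / (Real.sqrt 2 : ℂ)) • !![1, Complex.I; Complex.I, 1])
    (hD : D = !![r⁻¹, 0; 0, r])
    (Ψ : ℂ → Matrix (Fin 2) (Fin 2) ℂ)
    (hΨ : ∀ l : ℂ, l ≠ 0 → l ≠ 1 → ∀ i j : Fin 2,
      HasDerivAt (fun z => Ψ z i j) ((M l * Ψ l) i j) l)
    (A B C : ℂ → ℂ)
    (hA : ∀ l : ℂ, A l =
      Complex.I * ((v + Θ / 2) / l - (y * v + (v + Θ) / y) / (2 * (l - 1))))
    (hB : ∀ l : ℂ, B l =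
      -Complex.I * (x / 2 + (v + Θ / 2) / l - (v + Θ / 2) / (l - 1)) +
        (1 / 2) * (-(Θ / l) + (y * v - (v + Θ) / y) / (l - 1)))
    (hC : ∀ l : ℂ, C l =
      Complex.I * (x / 2 + (v + Θ / 2) / l - (v + Θ / 2) / (l - 1)) +
        (1 / 2) * (-(Θ / l) + (y * v - (v + Θ) / y) / (l - 1))) :
    ∀ l : ℂ, l ≠ 0 → l ≠ 1 → ∀ i j : Fin 2,
      HasDerivAt (fun z => (M₁ * D * Ψ z) i j)
        ((!![A l, B l; C l, -A l] * (M₁ * D * Ψ l)) i j) l := by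
  intro l hl0 hl1 i j
  have hl1' : l - 1 ≠ 0 := sub_ne_zero.mpr hl1
  have hr0 : r ≠ 0 := by
    rintro rfl
    apply hu
    rw [← hr]
    norm_num
  have hI : Complex.I ^ 2 = -1 := Complex.I_sq
  have key : M₁ * D * M l = !![A l, B l; C l, -A l] * (M₁ * D) := by
    have hMD : M₁ * D = (1 / (Real.sqrt 2 : ℂ)) •
        !![r⁻¹, Complex.I * r; Complex.I * r⁻¹, r] := by
      rw [hM₁, hD, Matrix.smul_mul]
      simp [Matrix.mul_fin_two]
    rw [hMD, Matrix.smul_mul, Matrix.mul_smul, hM, hA, hB, hC]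
    congr 1
    subst hr
    rw [Matrix.mul_fin_two, Matrix.mul_fin_two]
    ext a b
    fin_cases a <;> fin_cases b <;> simp <;> field_simp <;> ring_nf <;> 
      (try simp only [hI]) <;> ring
  rw [← Matrix.mul_assoc, ← key, Matrix.mul_assoc]
  have h0 := (hΨ l hl0 hl1 0 j).const_mul ((M₁ * D) i 0)
  have h1 := (hΨ l hl0 hl1 1 j).const_mul ((M₁ * D) i 1)
  have h := h0.add h1
  rw [Matrix.mul_apply (M := M₁ * D), Fin.sum_univ_two]
  refine h.congr_of_eventuallyEq (Filter.Eventually.of_forall fun z => ?_)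
  simp only [Matrix.mul_apply (M := M₁ * D), Fin.sum_univ_two, Pi.add_apply]
end

section
/- Let Θ ∈ ℝ∖ℤ and let ρ ∈ ℂ with ρ² ≠ −Θ². Define c = c(ρ) = −(1/(4π))·Log[(1+ρ²/Θ²)·sin²(πΘ)] and a = a(ρ) = (1/(2√π))·Γ(1+2ic)·e^{iπ/4}·e^{−6ic·log 2}·e^{πc}·[cos(πΘ) − (ρ/Θ)sin(πΘ)]. Assume Γ(1+2ic) ≠ 0 and define Y = (2√π·a/Γ(1+2ic))·e^{iπ/4}·e^{−πc}·e^{6ic·log 2}. Then (i·e^{iπΘ} − Y)·(iρ + Θ) = (i·e^{−iπΘ} − Y)·(iρ − Θ); that is, a(ρ) solves the equation (i·e^{iπΘ} − Y)/(i·e^{−iπΘ} − Y) = (iρ−Θ)/(iρ+Θ) obtained by equating the small-x and large-x values of the monodromy invariant I₁. -/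
/-- `a(ρ)` solves the equation obtained by equating the small-`x` and large-`x` values
of the monodromy invariant `I₁`. -/
theorem aFun_solves_invariant_equation
    (Θ : ℝ) (hΘ : ∀ n : ℤ, Θ ≠ (n : ℝ)) (ρ : ℂ) (hρ : ρ ^ 2 ≠ -(Θ : ℂ) ^ 2)
    (c a Y : ℂ) (hc : c = cFun Θ ρ) (ha : a = aFun Θ ρ)
    (hΓ : Complex.Gamma (1 + 2 * Complex.I * c) ≠ 0)
    (hY : Y = (2 * (Real.sqrt Real.pi : ℂ) * a / Complex.Gamma (1 + 2 * Complex.I * c)) *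
      Complex.exp (Complex.I * (Real.pi : ℂ) / 4) * Complex.exp (-((Real.pi : ℂ) * c)) *
      Complex.exp (6 * Complex.I * c * (Real.log 2 : ℂ))) :
    (Complex.I * Complex.exp (Complex.I * (Real.pi : ℂ) * (Θ : ℂ)) - Y) *
        (Complex.I * ρ + (Θ : ℂ)) =
      (Complex.I * Complex.exp (-(Complex.I * (Real.pi : ℂ) * (Θ : ℂ))) - Y) *
        (Complex.I * ρ - (Θ : ℂ)) := by
  have hΘ0 : (Θ : ℂ) ≠ 0 := by
    have := hΘ 0
    simpa using this
  have hpi : (Real.sqrt Real.pi : ℂ) ≠ 0 := by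
    exact_mod_cast (Real.sqrt_pos.mpr Real.pi_pos).ne'
  have h1 : Complex.exp (Complex.I * (Real.pi : ℂ) / 4) *
      Complex.exp (Complex.I * (Real.pi : ℂ) / 4) = Complex.I := by
    rw [← Complex.exp_add, show Complex.I * (Real.pi : ℂ) / 4 + Complex.I * (Real.pi : ℂ) / 4 = (Real.pi : ℂ) / 2 * Complex.I by ring, Complex.exp_pi_div_two_mul_I]
  have h2 : Complex.exp (-(6 * Complex.I * c * (Real.log 2 : ℂ))) *
      Complex.exp (6 * Complex.I * c * (Real.log 2 : ℂ)) = 1 := by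
    rw [← Complex.exp_add]; simp
  have h3 : Complex.exp ((Real.pi : ℂ) * c) * Complex.exp (-((Real.pi : ℂ) * c)) = 1 := by
    rw [← Complex.exp_add]; simp
  have hY2 : Y = Complex.I * (Complex.cos ((Real.pi : ℂ) * (Θ : ℂ)) -
      ρ / (Θ : ℂ) * Complex.sin ((Real.pi : ℂ) * (Θ : ℂ))) := by
    rw [hY, ha, aFun, ← hc]
    generalize Complex.cos ((Real.pi : ℂ) * (Θ : ℂ)) -
      ρ / (Θ : ℂ) * Complex.sin ((Real.pi : ℂ) * (Θ : ℂ)) = K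
    generalize Complex.exp (Complex.I * (Real.pi : ℂ) / 4) = E at *
    generalize Complex.exp (-(6 * Complex.I * c * (Real.log 2 : ℂ))) = A at *
    generalize Complex.exp (6 * Complex.I * c * (Real.log 2 : ℂ)) = A' at *
    generalize Complex.exp ((Real.pi : ℂ) * c) = B at *
    generalize Complex.exp (-((Real.pi : ℂ) * c)) = B' at *
    generalize Complex.Gamma (1 + 2 * Complex.I * c) = G at *
    generalize (Real.sqrt Real.pi : ℂ) = s at *
    have : 2 * s * (1 / (2 * s) * G * E * A * B * K) / G * E * B' * A'
        = (E * E) * (A * A') * (B * B') * K := by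
      field_simp
    rw [this, h1, h2, h3]; ring
  have e1 : Complex.exp (Complex.I * (Real.pi : ℂ) * (Θ : ℂ)) =
      Complex.cos ((Real.pi : ℂ) * (Θ : ℂ)) +
        Complex.sin ((Real.pi : ℂ) * (Θ : ℂ)) * Complex.I := by
    rw [← Complex.exp_mul_I]; congr 1; ring
  have e2 : Complex.exp (-(Complex.I * (Real.pi : ℂ) * (Θ : ℂ))) =
      Complex.cos ((Real.pi : ℂ) * (Θ : ℂ)) -
        Complex.sin ((Real.pi : ℂ) * (Θ : ℂ)) * Complex.I := by
    have := Complex.exp_mul_I (-((Real.pi : ℂ) * (Θ : ℂ)))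
    rw [Complex.cos_neg, Complex.sin_neg] at this
    rw [sub_eq_add_neg (Complex.cos _), ← neg_mul (Complex.sin _), ← this]; congr 1; ring
  rw [e1, e2, hY2]
  field_simp
  linear_combination (2 * ρ * (Θ : ℂ) * Complex.sin ((Real.pi : ℂ) * (Θ : ℂ))) * Complex.I_sq
end

section
/- Let Θ ∈ ℂ, δ > 0, and let y : [0, δ) → ℂ be twice continuously differentiable (with one-sided derivatives at 0), with y(0) ≠ 0 and y(0) ≠ 1. Suppose y satisfies the fifth Painlevé equation PV(Θ): y''(x) = (1/(2y) + 1/(y−1))·(y'(x))² − y'(x)/x + (1−2Θ)·y(x)/x − y(x)(y(x)+1)/(2(y(x)−1)) for all x ∈ (0, δ). Then y'(0) = (1−2Θ)·y(0). -/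
/-- A `C²` solution of the fifth Painlevé equation `PV(Θ)` on `[0, δ)` that is regular at
the origin with `y(0) ∉ {0, 1}` satisfies `y'(0) = (1 - 2Θ)·y(0)`. -/
theorem painleveV_derivative_at_origin
    (Θ : ℂ) (δ : ℝ) (hδ : 0 < δ) (y y' y'' : ℝ → ℂ)
    (hd1 : ∀ x ∈ Set.Ico (0 : ℝ) δ, HasDerivWithinAt y (y' x) (Set.Ico (0 : ℝ) δ) x)
    (hd2 : ∀ x ∈ Set.Ico (0 : ℝ) δ, HasDerivWithinAt y' (y'' x) (Set.Ico (0 : ℝ) δ) x)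
    (hcont : ContinuousOn y'' (Set.Ico (0 : ℝ) δ))
    (hy0 : y 0 ≠ 0) (hy1 : y 0 ≠ 1)
    (hPV : ∀ x ∈ Set.Ioo (0 : ℝ) δ,
      y'' x = (1 / (2 * y x) + 1 / (y x - 1)) * (y' x) ^ 2 - y' x / (x : ℂ) +
        (1 - 2 * Θ) * y x / (x : ℂ) - y x * (y x + 1) / (2 * (y x - 1))) :
    y' 0 = (1 - 2 * Θ) * y 0 := by
  have h0 : (0 : ℝ) ∈ Set.Ico (0 : ℝ) δ := ⟨le_refl _, hδ⟩
  have hsub : Set.Ioo (0 : ℝ) δ ⊆ Set.Ico (0 : ℝ) δ := Set.Ioo_subset_Ico_self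
  have cy : ContinuousWithinAt y (Set.Ioo (0 : ℝ) δ) 0 :=
    (hd1 0 h0).continuousWithinAt.mono hsub
  have cy' : ContinuousWithinAt y' (Set.Ioo (0 : ℝ) δ) 0 :=
    (hd2 0 h0).continuousWithinAt.mono hsub
  have cy'' : ContinuousWithinAt y'' (Set.Ioo (0 : ℝ) δ) 0 := (hcont 0 h0).mono hsub
  have cx : ContinuousWithinAt (fun x : ℝ => (x : ℂ)) (Set.Ioo (0 : ℝ) δ) 0 :=
    Complex.continuous_ofReal.continuousWithinAt
  have hy1' : y 0 - 1 ≠ 0 := sub_ne_zero.mpr hy1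
  have c1 : ContinuousWithinAt (fun x : ℝ => (x : ℂ) *
      ((1 / (2 * y x) + 1 / (y x - 1)) * (y' x) ^ 2
        - y x * (y x + 1) / (2 * (y x - 1)) - y'' x)) (Set.Ioo (0 : ℝ) δ) 0 := by
    have e1 : (2 : ℂ) * y 0 ≠ 0 := mul_ne_zero two_ne_zero hy0
    have e2 : (2 : ℂ) * (y 0 - 1) ≠ 0 := mul_ne_zero two_ne_zero hy1'
    have a1 := cy.const_mul (2 : ℂ)
    have a2 := cy.sub (continuousWithinAt_const (b := (1 : ℂ)))
    have a3 := a2.const_mul (2 : ℂ)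
    have k := continuousWithinAt_const (b := (1 : ℂ)) (s := Set.Ioo (0 : ℝ) δ) (x := (0 : ℝ))
    exact cx.mul (((((k.div a1 e1).add (k.div a2 hy1')).mul (cy'.pow 2)).sub
      ((cy.mul (cy.add k)).div a3 e2)).sub cy'')
  have c2 : ContinuousWithinAt (fun x : ℝ => y' x - (1 - 2 * Θ) * y x)
      (Set.Ioo (0 : ℝ) δ) 0 := cy'.sub (cy.const_mul _)
  have heq : ∀ x ∈ Set.Ioo (0 : ℝ) δ, (x : ℂ) *
      ((1 / (2 * y x) + 1 / (y x - 1)) * (y' x) ^ 2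
        - y x * (y x + 1) / (2 * (y x - 1)) - y'' x) = y' x - (1 - 2 * Θ) * y x := by
    intro x hx
    have hx0 : (x : ℂ) ≠ 0 := by exact_mod_cast hx.1.ne'
    rw [hPV x hx]
    generalize (1 / (2 * y x) + 1 / (y x - 1)) * (y' x) ^ 2 = A
    generalize y x * (y x + 1) / (2 * (y x - 1)) = B
    field_simp
    ring
  have hne : (nhdsWithin (0 : ℝ) (Set.Ioo (0 : ℝ) δ)).NeBot := left_nhdsWithin_Ioo_neBot hδ
  have t1 := c1.tendsto.congr' (eventually_nhdsWithin_of_forall heq)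
  have key := tendsto_nhds_unique t1 c2.tendsto
  simp only [Complex.ofReal_zero, zero_mul] at key
  exact sub_eq_zero.mp key.symm
end
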